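/- Let m ∈ ℕ, β̄ ∈ ℝ^m, and let L : ℝ^m → ℝ be twice continuously differentiable with globally Lipschitz Hessian. For each n ∈ ℕ let β̂_n be a random vector in ℝ^m such that L(β̂_n) and ‖β̂_n − β̄‖³ are integrable. Assume there is a matrix V ∈ ℝ^{m×m} such that n·E[(β̂_n − β̄)(β̂_n − β̄)ᵀ] → V and n·E[‖β̂_n − β̄‖³] → 0 as n → ∞. Then E[L(β̂_n)] = L(β̄) + ∇L(β̄)ᵀ E[β̂_n − β̄] + (2n)⁻¹ tr(∇²L(β̄) V) + o(n⁻¹) as n → ∞. -/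

import Mathlib

open Filter Matrix MeasureTheory Topology

/-- Second-order Taylor expansion with a cubic remainder bound for a function whose Hessian is
Lipschitz. -/
theorem abs_taylor_two_remainder_le {E : Type*} [NormedAddCommGroup E] [NormedSpace ℝ E]
    {L : E → ℝ} (hL : ContDiff ℝ 2 L) {c : NNReal}
    (hLip : LipschitzWith c (fun β => iteratedFDeriv ℝ 2 L β)) (b x : E) :
    |L x - L b - fderiv ℝ L b (x - b) - 2⁻¹ * iteratedFDeriv ℝ 2 L b ![x - b, x - b]|
      ≤ c * ‖x - b‖ ^ 3 := by
  have hd : Differentiable ℝ L := hL.differentiable (by norm_num)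
  have hd' : Differentiable ℝ (fderiv ℝ L) :=
    (hL.fderiv_right (m := 1) (by norm_num)).differentiable (by norm_num)
  set A := fderiv ℝ (fderiv ℝ L) b with hA
  have hsymm : ∀ u v, A u v = A v u :=
    fun u v => (hL.contDiffAt.isSymmSndFDerivAt (x := b) (by simp)).eq u v
  have hHess : ∀ y, ‖fderiv ℝ (fderiv ℝ L) y - A‖ ≤ c * ‖y - b‖ := by
    intro y
    refine ContinuousLinearMap.opNorm_le_bound₂ _ (by positivity) fun u v => ?_
    have h1 := (iteratedFDeriv ℝ 2 L y - iteratedFDeriv ℝ 2 L b).le_opNorm ![u, v]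
    have h2 : ‖iteratedFDeriv ℝ 2 L y - iteratedFDeriv ℝ 2 L b‖ ≤ c * ‖y - b‖ :=
      hLip.norm_sub_le y b
    simp only [_root_.sub_apply, iteratedFDeriv_two_apply, Fin.prod_univ_two,
      Matrix.cons_val_zero, Matrix.cons_val_one] at h1
    calc _ ≤ _ := h1
      _ ≤ c * ‖y - b‖ * (‖u‖ * ‖v‖) := by gcongr
      _ = _ := by ring
  set s := Metric.closedBall b ‖x - b‖
  have hconv : Convex ℝ s := convex_closedBall _ _
  have hb : b ∈ s := Metric.mem_closedBall_self (norm_nonneg _)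
  have hnorm : ∀ {y}, y ∈ s → ‖y - b‖ ≤ ‖x - b‖ := fun hy => mem_closedBall_iff_norm.1 hy
  have hGrad : ∀ y ∈ s, ‖fderiv ℝ L y - fderiv ℝ L b - A (y - b)‖ ≤ c * ‖x - b‖ ^ 2 := by
    intro y hy
    have hderiv : ∀ z ∈ s, HasFDerivWithinAt (fun z => fderiv ℝ L z - A z)
        (fderiv ℝ (fderiv ℝ L) z - A) s z := fun z _ =>
      ((hd' z).hasFDerivAt.sub A.hasFDerivAt).hasFDerivWithinAt
    have h := hconv.norm_image_sub_le_of_norm_hasFDerivWithin_le (C := c * ‖x - b‖) hderiv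
      (fun z hz => (hHess z).trans (by gcongr; exact hnorm hz)) hb hy
    calc _ = ‖fderiv ℝ L y - A y - (fderiv ℝ L b - A b)‖ := by
          rw [map_sub]; congr 1; abel
      _ ≤ c * ‖x - b‖ * ‖y - b‖ := h
      _ ≤ c * ‖x - b‖ * ‖x - b‖ := by gcongr; exact hnorm hy
      _ = _ := by ring
  have hderiv : ∀ z ∈ s, HasFDerivWithinAt
      (fun z => L z - fderiv ℝ L b z - 2⁻¹ * A (z - b) (z - b))
      (fderiv ℝ L z - fderiv ℝ L b - A (z - b)) s z := by
    intro z _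
    have hsub : HasFDerivAt (fun z => z - b) (ContinuousLinearMap.id ℝ E) z :=
      (hasFDerivAt_id z).sub_const b
    have hq := ((A.hasFDerivAt.comp z hsub).clm_apply hsub).const_mul (2⁻¹ : ℝ)
    have h := ((hd z).hasFDerivAt.sub (fderiv ℝ L b).hasFDerivAt).sub hq
    refine (h.congr_fderiv ?_).hasFDerivWithinAt
    ext v
    simp [hsymm v z, hsymm v b]
    ring
  have h := hconv.norm_image_sub_le_of_norm_hasFDerivWithin_le hderiv hGrad hb
    (mem_closedBall_iff_norm.2 le_rfl)
  rw [iteratedFDeriv_two_apply]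
  simp only [Matrix.cons_val_zero, Matrix.cons_val_one, ← hA]
  calc _ = ‖L x - fderiv ℝ L b x - 2⁻¹ * A (x - b) (x - b)
        - (L b - fderiv ℝ L b b - 2⁻¹ * A (b - b) (b - b))‖ := by
        rw [Real.norm_eq_abs]; congr 1; simp; ring
    _ ≤ _ := h
    _ = _ := by ring

/-- Coordinate expansion of a linear form on `Fin m → ℝ`. -/
theorem clm_apply_eq_sum_single {m : ℕ} (f : (Fin m → ℝ) →L[ℝ] ℝ) (h : Fin m → ℝ) :
    f h = ∑ i, f (Pi.single i 1) * h i := by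
  conv_lhs => rw [pi_eq_sum_univ' h]
  simp [map_sum, mul_comm]

/-- Coordinate expansion of the Hessian quadratic form on `Fin m → ℝ`. -/
theorem iteratedFDeriv_two_apply_eq_sum_single {m : ℕ} (L : (Fin m → ℝ) → ℝ)
    (b h : Fin m → ℝ) :
    iteratedFDeriv ℝ 2 L b ![h, h] = ∑ i, ∑ j,
      iteratedFDeriv ℝ 2 L b ![Pi.single i 1, Pi.single j 1] * (h j * h i) := by
  simp only [iteratedFDeriv_two_apply, Matrix.cons_val_zero, Matrix.cons_val_one]
  have h1 : fderiv ℝ (fderiv ℝ L) b h h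
      = ∑ i, fderiv ℝ (fderiv ℝ L) b (Pi.single i 1) h * h i :=
    clm_apply_eq_sum_single ((fderiv ℝ (fderiv ℝ L) b).flip h) h
  rw [h1]
  refine Finset.sum_congr rfl fun i _ => ?_
  rw [clm_apply_eq_sum_single, Finset.sum_mul]
  exact Finset.sum_congr rfl fun j _ => by ring



/-- the paper's Lemma 1 in generalized form (second-order expansion of
the risk `E[L(β̂_n)]`). -/
theorem stmt_0 {Ω : Type*} [MeasurableSpace Ω] (P : Measure Ω) [IsProbabilityMeasure P]
    (m : ℕ) (βbar : Fin m → ℝ) (L : (Fin m → ℝ) → ℝ)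
    (hL : ContDiff ℝ 2 L)
    (c : NNReal) (hLip : LipschitzWith c (fun β => iteratedFDeriv ℝ 2 L β))
    (βhat : ℕ → Ω → (Fin m → ℝ)) (hmeas : ∀ n, Measurable (βhat n))
    (hint1 : ∀ n, Integrable (fun ω => L (βhat n ω)) P)
    (hint3 : ∀ n, Integrable (fun ω => ‖βhat n ω - βbar‖ ^ 3) P)
    (V : Matrix (Fin m) (Fin m) ℝ)
    (hV : ∀ i j, Tendsto
      (fun n : ℕ => (n : ℝ) * ∫ ω, (βhat n ω i - βbar i) * (βhat n ω j - βbar j) ∂P)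
      atTop (𝓝 (V i j)))
    (h3 : Tendsto (fun n : ℕ => (n : ℝ) * ∫ ω, ‖βhat n ω - βbar‖ ^ 3 ∂P) atTop (𝓝 0)) :
    Tendsto (fun n : ℕ => (n : ℝ) *
      ((∫ ω, L (βhat n ω) ∂P)
        - (L βbar
          + (∑ i, fderiv ℝ L βbar (Pi.single i 1) * ∫ ω, (βhat n ω i - βbar i) ∂P)
          + (2 * (n : ℝ))⁻¹ *
            ((Matrix.of fun i j =>
              iteratedFDeriv ℝ 2 L βbar ![Pi.single i 1, Pi.single j 1]) * V).trace)))
      atTop (𝓝 0) := by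
  have hm : ∀ n i, Measurable fun ω => βhat n ω i - βbar i := fun n i =>
    ((measurable_pi_apply i).comp (hmeas n)).sub_const _
  have hcoord : ∀ n ω i, |βhat n ω i - βbar i| ≤ ‖βhat n ω - βbar‖ := fun n ω i =>
    norm_le_pi_norm (βhat n ω - βbar) i
  have hdom : ∀ n, Integrable (fun ω => 1 + ‖βhat n ω - βbar‖ ^ 3) P := fun n =>
    (integrable_const 1).add (hint3 n)
  have hi1 : ∀ n i, Integrable (fun ω => βhat n ω i - βbar i) P := fun n i => by
    refine (hdom n).mono' (hm n i).aestronglyMeasurable (.of_forall fun ω => ?_)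
    refine (hcoord n ω i).trans ?_
    have := norm_nonneg (βhat n ω - βbar)
    nlinarith [mul_nonneg this (sq_nonneg (‖βhat n ω - βbar‖ - 1)),
      sq_nonneg (‖βhat n ω - βbar‖ - 1)]
  have hi2 : ∀ n i j, Integrable
      (fun ω => (βhat n ω i - βbar i) * (βhat n ω j - βbar j)) P := fun n i j => by
    refine (hdom n).mono' ((hm n i).mul (hm n j)).aestronglyMeasurable
      (.of_forall fun ω => ?_)
    have h0 := norm_nonneg (βhat n ω - βbar)
    rw [Real.norm_eq_abs, abs_mul]
    refine (mul_le_mul (hcoord n ω i) (hcoord n ω j) (abs_nonneg _) h0).trans ?_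
    nlinarith [mul_nonneg h0 (sq_nonneg (‖βhat n ω - βbar‖ - 1)),
      sq_nonneg (‖βhat n ω - βbar‖ - 1)]
  set H : Fin m → Fin m → ℝ := fun i j =>
    iteratedFDeriv ℝ 2 L βbar ![Pi.single i 1, Pi.single j 1]
  set g : Fin m → ℝ := fun i => fderiv ℝ L βbar (Pi.single i 1)
  set R : ℕ → Ω → ℝ := fun n ω => L (βhat n ω) - L βbar
    - ∑ i, g i * (βhat n ω i - βbar i)
    - 2⁻¹ * ∑ i, ∑ j, H i j * ((βhat n ω j - βbar j) * (βhat n ω i - βbar i)) with hR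
  have hRle : ∀ n ω, |R n ω| ≤ c * ‖βhat n ω - βbar‖ ^ 3 := fun n ω => by
    have h := abs_taylor_two_remainder_le hL hLip βbar (βhat n ω)
    rwa [clm_apply_eq_sum_single, iteratedFDeriv_two_apply_eq_sum_single] at h
  have hlin : ∀ n, Integrable (fun ω => ∑ i, g i * (βhat n ω i - βbar i)) P := fun n =>
    integrable_finsetSum _ fun i _ => (hi1 n i).const_mul _
  have hrow : ∀ n i, Integrable
      (fun ω => ∑ j, H i j * ((βhat n ω j - βbar j) * (βhat n ω i - βbar i))) P := fun n i =>
    integrable_finsetSum _ fun j _ => (hi2 n j i).const_mul _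
  have hquad : ∀ n, Integrable (fun ω => 2⁻¹ * ∑ i, ∑ j,
      H i j * ((βhat n ω j - βbar j) * (βhat n ω i - βbar i))) P := fun n =>
    (integrable_finsetSum _ fun i _ => hrow n i).const_mul _
  have hconst : Integrable (fun _ : Ω => L βbar) P := integrable_const _
  have hLc : ∀ n, Integrable (fun ω => L (βhat n ω) - L βbar) P := fun n =>
    (hint1 n).sub hconst
  have hLlin : ∀ n, Integrable
      (fun ω => L (βhat n ω) - L βbar - ∑ i, g i * (βhat n ω i - βbar i)) P := fun n =>
    (hLc n).sub (hlin n)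
  have hRint : ∀ n, ∫ ω, R n ω ∂P = (∫ ω, L (βhat n ω) ∂P) - L βbar
      - (∑ i, g i * ∫ ω, (βhat n ω i - βbar i) ∂P)
      - 2⁻¹ * ∑ i, ∑ j, H i j *
        ∫ ω, (βhat n ω j - βbar j) * (βhat n ω i - βbar i) ∂P := fun n => by
    simp only [hR]
    rw [integral_sub (hLlin n) (hquad n),
      integral_sub (hLc n) (hlin n), integral_sub (hint1 n) hconst,
      integral_const_mul, integral_finsetSum _ fun i _ => (hi1 n i).const_mul _,
      integral_finsetSum _ fun i _ => hrow n i]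
    congr 1
    · simp [integral_const_mul]
    · congr 1
      refine Finset.sum_congr rfl fun i _ => ?_
      rw [integral_finsetSum _ fun j _ => (hi2 n j i).const_mul _]
      simp only [integral_const_mul]
  have hRlim : Tendsto (fun n : ℕ => (n : ℝ) * ∫ ω, R n ω ∂P) atTop (𝓝 0) := by
    refine squeeze_zero_norm (fun n => ?_) (by simpa using h3.const_mul (c : ℝ))
    have h : ‖∫ ω, R n ω ∂P‖ ≤ ∫ ω, c * ‖βhat n ω - βbar‖ ^ 3 ∂P :=
      norm_integral_le_of_norm_le ((hint3 n).const_mul _) (.of_forall fun ω => hRle n ω)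
    rw [integral_const_mul] at h
    rw [norm_mul, Real.norm_natCast]
    calc _ ≤ (n : ℝ) * (c * ∫ ω, ‖βhat n ω - βbar‖ ^ 3 ∂P) := by gcongr
      _ = _ := by ring
  have hQlim : Tendsto (fun n : ℕ => 2⁻¹ * ∑ i, ∑ j, H i j *
      ((n : ℝ) * ∫ ω, (βhat n ω j - βbar j) * (βhat n ω i - βbar i) ∂P)) atTop
      (𝓝 (2⁻¹ * ∑ i, ∑ j, H i j * V j i)) :=
    (tendsto_finsetSum _ fun i _ => tendsto_finsetSum _ fun j _ =>
      (hV j i).const_mul _).const_mul _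
  have hlim := hRlim.add (hQlim.sub_const (2⁻¹ * ∑ i, ∑ j, H i j * V j i))
  rw [sub_self, add_zero] at hlim
  refine hlim.congr' ?_
  filter_upwards [eventually_gt_atTop 0] with n hn
  have hn' : (n : ℝ) ≠ 0 := by positivity
  have htrace : ((Matrix.of H) * V).trace = ∑ i, ∑ j, H i j * V j i := by
    simp [Matrix.trace, Matrix.mul_apply]
  have hpull : ∑ i, ∑ j, H i j *
      ((n : ℝ) * ∫ ω, (βhat n ω j - βbar j) * (βhat n ω i - βbar i) ∂P)
      = n * ∑ i, ∑ j, H i j * ∫ ω, (βhat n ω j - βbar j) * (βhat n ω i - βbar i) ∂P := by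
    simp only [Finset.mul_sum, mul_left_comm]
  rw [hRint, hpull, htrace]
  field_simp
  ring
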